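/- arXiv:2003.05041 — 2 statements merged into one kernel-verified Lean document; each statement's English description precedes it below -/
import Mathlib

section
/- Let F be a field of characteristic zero and let A(λ), B(λ) ∈ M_{n×n}(F[λ]) be nonsingular matrices that are equivalent, with common Smith normal form S(λ) = diag(s_1(λ), ..., s_{n−1}(λ), s_n(λ)). Suppose s_n(λ) = (λ−α_1)^{k_1}(λ−α_2)^{k_2}···(λ−α_r)^{k_r}, where α_1, ..., α_r ∈ F are pairwise distinct and k_i ≥ 1. Let d(λ) = s_1(λ)···s_{n−1}(λ) and let C(λ) ∈ M_{n×n}(F[λ]) be the matrix with B*(λ) = d(λ)·C(λ), where B*(λ) is the adjugate of B(λ). Then A(λ) and B(λ) are semi-scalar equivalent if and only if there exists a nonsingular constant matrix V ∈ M_{n×n}(F) such that for every i = 1, ..., r and every j with 0 ≤ j ≤ k_i − 1, the j-th entrywise formal derivative of the matrix C(λ)·V·A(λ) evaluated at α_i is the zero matrix (equivalently, s_n(λ) divides every entry of C(λ)·V·A(λ)). -/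
open Polynomial

theorem aux_pow_dvd_iff {F : Type*} [Field F] [CharZero F] (f : F[X]) (a : F) (k : ℕ) :
    (X - Polynomial.C a) ^ k ∣ f ↔ ∀ j < k, (derivative^[j] f).eval a = 0 := by
  by_cases hf : f = 0
  · subst hf
    simp
  · rw [← Polynomial.le_rootMultiplicity_iff hf]
    rcases k with _ | k
    · simp
    · rw [Nat.succ_le_iff, Polynomial.lt_rootMultiplicity_iff_isRoot_iterate_derivative hf]
      simp only [Nat.lt_succ_iff, IsRoot.def]

theorem aux_prod_dvd_iff {F : Type*} [Field F] [CharZero F] {r : ℕ} (f : F[X])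
    (α : Fin r → F) (hα : Function.Injective α) (k : Fin r → ℕ) :
    (∏ i, (X - Polynomial.C (α i)) ^ k i) ∣ f ↔
      ∀ i, ∀ j < k i, (derivative^[j] f).eval (α i) = 0 := by
  simp only [← aux_pow_dvd_iff]
  constructor
  · intro h i
    exact (Finset.dvd_prod_of_mem (fun i => (X - Polynomial.C (α i)) ^ k i) (Finset.mem_univ i)).trans h
  · intro h
    refine Fintype.prod_dvd_of_coprime ?_ h
    intro i j hij
    exact IsCoprime.pow (Polynomial.pairwise_coprime_X_sub_C hα hij)

theorem aux_det_smith {F : Type*} [Field F] {n : ℕ} (A : Matrix (Fin n) (Fin n) F[X])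
    (s : Fin n → F[X])
    (h : ∃ U V : Matrix (Fin n) (Fin n) F[X],
      IsUnit U.det ∧ IsUnit V.det ∧ U * A * V = Matrix.diagonal s) :
    Associated A.det (∏ i, s i) := by
  obtain ⟨U, V, hU, hV, h⟩ := h
  have := congrArg Matrix.det h
  rw [Matrix.det_mul, Matrix.det_mul, Matrix.det_diagonal] at this
  rw [← this]
  obtain ⟨u, hu⟩ := hU
  obtain ⟨v, hv⟩ := hV
  refine ⟨u * v, ?_⟩
  rw [← hu, ← hv]
  push_cast
  ring


open Polynomial

/-- **Theorem 3.1.** Let `F` be a field of characteristic zero and let `A(λ), B(λ)` be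
nonsingular `n × n` polynomial matrices that are equivalent, with common Smith normal form
`diag(s₁, …, sₙ)`, where `sₙ(λ) = (λ - α₁)^{k₁} ⋯ (λ - α_r)^{k_r}` with the `αᵢ ∈ F`
pairwise distinct. Let `d = s₁ ⋯ s_{n-1}` and write `B*(λ) = d(λ)·C(λ)`. Then
`A(λ)` and `B(λ)` are semi-scalar equivalent iff there is a nonsingular constant matrix
`V` such that for every `i` and `0 ≤ j ≤ kᵢ - 1` the `j`-th entrywise formal derivative
of `C(λ)·V·A(λ)` vanishes at `αᵢ` (equivalently, `sₙ` divides every entry of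
`C(λ)·V·A(λ)`). -/
theorem semi_scalar_equivalent_iff_exists_nonsingular_solution
    {F : Type*} [Field F] [CharZero F] {n r : ℕ} (hn : 1 ≤ n)
    (A B : Matrix (Fin n) (Fin n) F[X]) (hA : A.det ≠ 0) (hB : B.det ≠ 0)
    (s : Fin n → F[X]) (hmonic : ∀ i, (s i).Monic)
    (hchain : ∀ i j : Fin n, i ≤ j → s i ∣ s j)
    (hsmithA : ∃ U V : Matrix (Fin n) (Fin n) F[X],
      IsUnit U.det ∧ IsUnit V.det ∧ U * A * V = Matrix.diagonal s)
    (hsmithB : ∃ U V : Matrix (Fin n) (Fin n) F[X],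
      IsUnit U.det ∧ IsUnit V.det ∧ U * B * V = Matrix.diagonal s)
    (α : Fin r → F) (hα : Function.Injective α)
    (k : Fin r → ℕ) (hk : ∀ i, 1 ≤ k i)
    (hfact : s ⟨n - 1, by omega⟩ = ∏ i, (X - Polynomial.C (α i)) ^ k i)
    (d : F[X]) (hd : d = ∏ i ∈ Finset.univ.filter (fun i : Fin n => (i : ℕ) < n - 1), s i)
    (Cm : Matrix (Fin n) (Fin n) F[X]) (hCm : ∀ p q, B.adjugate p q = d * Cm p q) :
    (∃ P : Matrix (Fin n) (Fin n) F, IsUnit P.det ∧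
      ∃ Q : Matrix (Fin n) (Fin n) F[X], IsUnit Q.det ∧
        A = P.map Polynomial.C * B * Q) ↔
    (∃ V : Matrix (Fin n) (Fin n) F, V.det ≠ 0 ∧
      ∀ i : Fin r, ∀ j < k i, ∀ p q : Fin n,
        ((fun f => derivative f)^[j] ((Cm * V.map Polynomial.C * A) p q)).eval (α i) = 0) := by
  have hassB := aux_det_smith B s hsmithB
  have hassAB : Associated A.det B.det := (aux_det_smith A s hsmithA).trans hassB.symm
  set t : F[X] := s ⟨n - 1, by omega⟩ with ht
  have ht0 : t ≠ 0 := (hmonic _).ne_zero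
  have hprod : ∏ i, s i = d * t := by
    rw [hd, ← Finset.prod_filter_mul_prod_filter_not Finset.univ
      (fun i : Fin n => (i : ℕ) < n - 1)]
    congr 1
    rw [show Finset.univ.filter (fun i : Fin n => ¬ (i : ℕ) < n - 1)
      = {⟨n - 1, by omega⟩} from ?_, Finset.prod_singleton]
    ext i
    simp only [Finset.mem_filter, Finset.mem_univ, true_and, Finset.mem_singleton, Fin.ext_iff]
    omega
  have hd0 : d ≠ 0 := by
    rw [hd]
    exact Finset.prod_ne_zero_iff.mpr fun i _ => (hmonic i).ne_zero
  obtain ⟨u, hu⟩ := hassB.symm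
  rw [hprod] at hu
  have hadj : B.adjugate = d • Cm := by
    ext1 p q
    simp [hCm]
  have hCB : Cm * B = (t * (u : F[X])) • (1 : Matrix (Fin n) (Fin n) F[X]) := by
    have h := Matrix.adjugate_mul B
    rw [hadj, ← hu, Matrix.smul_mul, mul_assoc, mul_smul] at h
    exact smul_right_injective _ hd0 h
  have hBC : B * Cm = (t * (u : F[X])) • (1 : Matrix (Fin n) (Fin n) F[X]) := by
    have h := Matrix.mul_adjugate B
    rw [hadj, ← hu, Matrix.mul_smul, mul_assoc, mul_smul] at h
    exact smul_right_injective _ hd0 h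
  have key : ∀ V : Matrix (Fin n) (Fin n) F,
      (∀ i : Fin r, ∀ j < k i, ∀ p q : Fin n,
        ((fun f => derivative f)^[j] ((Cm * V.map Polynomial.C * A) p q)).eval (α i) = 0) ↔
      ∀ p q : Fin n, t ∣ (Cm * V.map Polynomial.C * A) p q := by
    intro V
    rw [hfact]
    simp only [aux_prod_dvd_iff _ α hα k]
    exact ⟨fun h p q i j hj => h i j hj p q, fun h i j hj p q => h p q i j hj⟩
  have hmap : ∀ V W : Matrix (Fin n) (Fin n) F, V * W = 1 →
      V.map Polynomial.C * W.map Polynomial.C = 1 := by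
    intro V W h
    rw [← Matrix.map_mul, h, Matrix.map_one _ (map_zero _) (map_one _)]
  simp only [key]
  constructor
  · rintro ⟨P, hP, Q, hQ, hAQ⟩
    refine ⟨P⁻¹, (Matrix.isUnit_nonsing_inv_det P hP).ne_zero, ?_⟩
    have h1 := hmap _ _ (Matrix.nonsing_inv_mul P hP)
    have h2 : Cm * (P⁻¹).map Polynomial.C * A = (t * (u : F[X])) • Q := by
      calc Cm * (P⁻¹).map Polynomial.C * A
          = Cm * ((P⁻¹).map Polynomial.C * P.map Polynomial.C) * B * Q := by
            rw [hAQ]; simp only [Matrix.mul_assoc]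
        _ = _ := by rw [h1, Matrix.mul_one, hCB, Matrix.smul_mul, Matrix.one_mul]
    intro p q
    rw [h2, Matrix.smul_apply, smul_eq_mul, mul_assoc]
    exact dvd_mul_right _ _
  · rintro ⟨V, hV, h⟩
    choose Q hQ using h
    have hQ' : Cm * V.map Polynomial.C * A = t • Matrix.of Q := by
      ext1 p q
      simp [hQ]
    have h1 : (u : F[X]) • (V.map Polynomial.C * A) = B * Matrix.of Q := by
      have h2 := congrArg (fun M => B * M) hQ'
      simp only [← Matrix.mul_assoc] at h2
      rw [hBC, Matrix.mul_smul, Matrix.smul_mul, Matrix.smul_mul, Matrix.one_mul, mul_smul] at h2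
      exact smul_right_injective _ ht0 h2
    have hVu : IsUnit V.det := isUnit_iff_ne_zero.mpr hV
    have h3 : V.map Polynomial.C * A = B * ((↑u⁻¹ : F[X]) • Matrix.of Q) := by
      rw [Matrix.mul_smul, ← h1, smul_smul, Units.inv_mul, one_smul]
    have h4 := hmap _ _ (Matrix.nonsing_inv_mul V hVu)
    refine ⟨V⁻¹, Matrix.isUnit_nonsing_inv_det V hVu, (↑u⁻¹ : F[X]) • Matrix.of Q, ?_, ?_⟩
    · have h5 := congrArg Matrix.det h3
      rw [Matrix.det_mul, Matrix.det_mul] at h5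
      obtain ⟨w, hw⟩ := hassAB.symm
      have h6 : (V.map Polynomial.C).det = Polynomial.C V.det := by
        rw [RingHom.map_det]; rfl
      rw [h6, ← hw, mul_left_comm] at h5
      rw [← mul_left_cancel₀ hB h5]
      exact (Polynomial.isUnit_C.mpr hVu).mul w.isUnit
    · rw [Matrix.mul_assoc, ← h3, ← Matrix.mul_assoc, h4, Matrix.one_mul]
end

section
/- Let F be an infinite field and let A(λ) ∈ M_{n×n}(F[λ]) be a nonsingular matrix with invariant factors s_1(λ) | s_2(λ) | ... | s_n(λ). Then A(λ) is semi-scalar equivalent to a lower triangular matrix S_l(λ) ∈ M_{n×n}(F[λ]) such that: (a) the diagonal entries satisfy (S_l)_{ii}(λ) = s_i(λ) for i = 1, ..., n, and (b) s_i(λ) divides (S_l)_{ji}(λ) for all i, j with 1 ≤ i < j ≤ n. -/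
open Polynomial

/-- Choose a constant row vector avoiding all maximal ideals. -/
lemma exists_row_aux {F R : Type*} [Field F] [Infinite F] [CommRing R] [Algebra F R]
    [Finite (MaximalSpectrum R)] {n : ℕ} (w : Fin (n + 1) → R)
    (hw : ∃ v : Fin (n + 1) → R, ∑ i, v i * w i = 1) :
    ∃ p : Fin (n + 1) → F, p 0 ≠ 0 ∧ IsUnit (∑ i, algebraMap F R (p i) * w i) := by
  classical
  let φ : (Fin (n + 1) → F) →ₗ[F] R := Fintype.linearCombination F w
  have hφ : ∀ p, φ p = ∑ i, algebraMap F R (p i) * w i := fun p => by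
    simp [φ, Fintype.linearCombination_apply, Algebra.smul_def]
  let H : Option (MaximalSpectrum R) → Subspace F (Fin (n + 1) → F) := fun o =>
    match o with
    | none => LinearMap.ker (LinearMap.proj (R := F) (φ := fun _ : Fin (n + 1) => F) 0)
    | some 𝔪 => (𝔪.asIdeal.restrictScalars F).comap φ
  have hH : ∀ o, H o ≠ ⊤ := by
    intro o ho
    cases o with
    | none =>
      have : (fun _ => 1 : Fin (n + 1) → F) ∈ H none := by rw [ho]; trivial
      simp [H] at this
    | some 𝔪 =>
      apply 𝔪.isMaximal.ne_top
      rw [Ideal.eq_top_iff_one]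
      obtain ⟨v, hv⟩ := hw
      rw [← hv]
      refine Ideal.sum_mem _ fun i _ => Ideal.mul_mem_left _ _ ?_
      have : (Pi.single i 1 : Fin (n + 1) → F) ∈ H (some 𝔪) := by rw [ho]; trivial
      have h2 : φ (Pi.single i 1) ∈ 𝔪.asIdeal := this
      simpa [φ] using h2
  have : Fintype (Option (MaximalSpectrum R)) := Fintype.ofFinite _
  have key := Subspace.biUnion_ne_univ_of_top_notMem (s := Finset.univ.image H) (by
    simpa using hH)
  rw [Set.ne_univ_iff_exists_notMem] at key
  obtain ⟨p, hp⟩ := key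
  have hp' : ∀ o, p ∉ H o := by
    intro o ho
    apply hp
    simp only [Set.mem_iUnion]
    exact ⟨H o, by simp, ho⟩
  refine ⟨p, ?_, ?_⟩
  · have := hp' none
    simpa [H] using this
  · rw [← hφ]
    by_contra hu
    obtain ⟨𝔪, h𝔪, hmem⟩ := exists_max_ideal_of_mem_nonunits hu
    exact hp' (some ⟨𝔪, h𝔪⟩) hmem

/-- Block matrix with a `1 × 1` corner. -/
def cornerAux {R : Type*} {n : ℕ} (a : R) (b c : Fin n → R) (d : Matrix (Fin n) (Fin n) R) :
    Matrix (Fin (n + 1)) (Fin (n + 1)) R :=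
  Matrix.of (Fin.cons (Fin.cons a b) fun i => Fin.cons (c i) (d i))

lemma cornerAux_eta {R : Type*} {n : ℕ} (M : Matrix (Fin (n + 1)) (Fin (n + 1)) R) :
    M = cornerAux (M 0 0) (fun j => M 0 j.succ) (fun i => M i.succ 0)
      (fun i j => M i.succ j.succ) := by
  ext i j
  refine Fin.cases ?_ (fun i => ?_) i <;> refine Fin.cases ?_ (fun j => ?_) j <;> simp [cornerAux]

lemma det_cornerAux_zero {R : Type*} [CommRing R] {n : ℕ} (a : R) (b : Fin n → R)
    (d : Matrix (Fin n) (Fin n) R) : (cornerAux a b 0 d).det = a * d.det := by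
  rw [Matrix.det_succ_column_zero, Fin.sum_univ_succ]
  simp only [cornerAux, Fin.succAbove_zero]
  simp
  rfl

lemma cornerAux_mul {R : Type*} [CommRing R] {n : ℕ} (a a' : R) (b c b' c' : Fin n → R)
    (d d' : Matrix (Fin n) (Fin n) R) :
    cornerAux a b c d * cornerAux a' b' c' d' =
      cornerAux (a * a' + ∑ k, b k * c' k) (fun j => a * b' j + ∑ k, b k * d' k j)
        (fun i => c i * a' + ∑ k, d i k * c' k)
        (fun i j => c i * b' j + (d * d') i j) := by
  ext i j
  refine Fin.cases ?_ (fun i => ?_) i <;> refine Fin.cases ?_ (fun j => ?_) j <;>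
    simp [cornerAux, Matrix.mul_apply, Fin.sum_univ_succ]

/-- After multiplication by a constant matrix, an LU decomposition exists. -/
lemma exists_lu_aux {F R : Type*} [Field F] [Infinite F] [CommRing R] [Algebra F R]
    [Finite (MaximalSpectrum R)] : ∀ (n : ℕ) (W : Matrix (Fin n) (Fin n) R), IsUnit W.det →
    ∃ P : Matrix (Fin n) (Fin n) F, IsUnit P.det ∧ ∃ L U : Matrix (Fin n) (Fin n) R,
      (∀ i j, i < j → L i j = 0) ∧ (∀ i, L i i = 1) ∧ (∀ i j, j < i → U i j = 0) ∧
      P.map (algebraMap F R) * W = L * U := by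
  intro n
  induction n with
  | zero =>
    intro W _
    exact ⟨1, by simp, 1, 1, fun i => i.elim0, fun i => i.elim0, fun i => i.elim0,
      Subsingleton.elim _ _⟩
  | succ n ih =>
    intro W hW
    obtain ⟨p, hp0, hpu⟩ := exists_row_aux (F := F) (fun i => W i 0) ⟨fun i => W⁻¹ 0 i, by
      have := congrFun (congrFun (Matrix.nonsing_inv_mul W hW) 0) 0
      simpa [Matrix.mul_apply] using this⟩
    let P₁ : Matrix (Fin (n + 1)) (Fin (n + 1)) F :=
      cornerAux (p 0) (fun j => p j.succ) 0 1
    have hP₁ : IsUnit P₁.det := by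
      simp only [P₁, det_cornerAux_zero, Matrix.det_one, mul_one]
      exact hp0.isUnit
    set M := P₁.map (algebraMap F R) * W with hM
    have hMdet : IsUnit M.det := by
      rw [hM, Matrix.det_mul]
      refine IsUnit.mul ?_ hW
      have := hP₁.map (algebraMap F R)
      rwa [RingHom.map_det] at this
    have hM00 : IsUnit (M 0 0) := by
      convert hpu using 1
      simp [hM, Matrix.mul_apply, P₁, Fin.sum_univ_succ, cornerAux]
    obtain ⟨a', ha'⟩ := hM00.exists_right_inv
    set a := M 0 0 with ha
    set b : Fin n → R := fun j => M 0 j.succ with hb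
    set c : Fin n → R := fun i => M i.succ 0 with hc
    set d : Matrix (Fin n) (Fin n) R := fun i j => M i.succ j.succ with hd
    have hMe : M = cornerAux a b c d := cornerAux_eta M
    let W' : Matrix (Fin n) (Fin n) R :=
      Matrix.of fun i j => d i j - c i * a' * b j
    have hW'a : ∀ i j, W' i j = d i j - c i * a' * b j := fun i j => rfl
    have hW' : IsUnit W'.det := by
      have h1 : M = (cornerAux 1 0 (fun i => c i * a') 1) * cornerAux a b 0 W' := by
        rw [hMe, cornerAux_mul]
        congr 1
        · simp
        · simp
        · funext i
          simp only [Pi.zero_apply, mul_zero, Finset.sum_const_zero, add_zero]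
          linear_combination (-c i) * ha'
        · funext i j
          rw [Matrix.one_mul, hW'a]
          ring
      have h2 := hMdet
      rw [h1, Matrix.det_mul, det_cornerAux_zero] at h2
      exact isUnit_of_mul_isUnit_right (isUnit_of_mul_isUnit_right h2)
    obtain ⟨P', hP', L', U', hL', hL1, hU', hE⟩ := ih W' hW'
    set P'' := P'.map (algebraMap F R) with hP''
    refine ⟨cornerAux 1 0 0 P' * P₁, ?_, cornerAux 1 0 (fun i => (∑ k, P'' i k * c k) * a') L',
      cornerAux a b 0 U', ?_, ?_, ?_, ?_⟩
    · rw [Matrix.det_mul, det_cornerAux_zero, one_mul]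
      exact hP'.mul hP₁
    · intro i j
      refine Fin.cases ?_ (fun i => ?_) i <;> refine Fin.cases ?_ (fun j => ?_) j <;>
        simp [cornerAux]
      exact hL' i j
    · intro i
      refine Fin.cases ?_ (fun i => ?_) i <;> simp [cornerAux, hL1]
    · intro i j
      refine Fin.cases ?_ (fun i => ?_) i <;> refine Fin.cases ?_ (fun j => ?_) j <;>
        simp [cornerAux]
      exact hU' i j
    · have hmap : (cornerAux 1 0 0 P').map (algebraMap F R) = cornerAux 1 0 0 P'' := by
        ext i j
        refine Fin.cases ?_ (fun i => ?_) i <;> refine Fin.cases ?_ (fun j => ?_) j <;>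
          simp [cornerAux, P'']
      rw [Matrix.map_mul, Matrix.mul_assoc, ← hM, hmap, hMe, cornerAux_mul, cornerAux_mul]
      congr 1
      · simp
      · simp
      · funext i
        simp only [Pi.zero_apply, mul_zero, zero_mul, Finset.sum_const_zero, add_zero, zero_add]
        linear_combination (-(∑ k, P'' i k * c k)) * ha'
      · funext i j
        rw [← hE]
        simp only [Pi.zero_apply, zero_mul, zero_add, Matrix.mul_apply, hW'a, mul_sub,
          Finset.sum_sub_distrib, Finset.sum_mul]
        have : ∀ k, P'' i k * (c k * a' * b j) = P'' i k * c k * a' * b j := fun k => by ring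
        simp only [this]
        ring

/-- (Kazimirs'kii's triangular form.) Over an infinite field `F`, every nonsingular
`n × n` polynomial matrix `A(λ)` with invariant factors `s₁ ∣ s₂ ∣ ⋯ ∣ sₙ` is
semi-scalar equivalent to a lower triangular matrix `S_l(λ)` whose diagonal entries are
`s₁, …, sₙ` and such that `sᵢ` divides the entry in position `(j, i)` for `i < j`. -/
theorem nonsingular_semi_scalar_equivalent_lower_triangular
    {F : Type*} [Field F] [Infinite F] {n : ℕ}
    (A : Matrix (Fin n) (Fin n) F[X]) (hA : A.det ≠ 0)
    (s : Fin n → F[X]) (hmonic : ∀ i, (s i).Monic)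
    (hchain : ∀ i j : Fin n, i ≤ j → s i ∣ s j)
    (hsmith : ∃ U V : Matrix (Fin n) (Fin n) F[X],
      IsUnit U.det ∧ IsUnit V.det ∧ U * A * V = Matrix.diagonal s) :
    ∃ Sl : Matrix (Fin n) (Fin n) F[X],
      (∃ P : Matrix (Fin n) (Fin n) F, IsUnit P.det ∧
        ∃ Q : Matrix (Fin n) (Fin n) F[X], IsUnit Q.det ∧
          A = P.map Polynomial.C * Sl * Q) ∧
      (∀ i j : Fin n, i < j → Sl i j = 0) ∧
      (∀ i : Fin n, Sl i i = s i) ∧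
      (∀ i j : Fin n, i < j → s i ∣ Sl j i) := by
  classical
  obtain ⟨U, V, hU, hV, hUV⟩ := hsmith
  obtain ⟨m, hm, hsm⟩ : ∃ m : F[X], m.Monic ∧ ∀ i, s i ∣ m := by
    cases n with
    | zero => exact ⟨1, monic_one, fun i => i.elim0⟩
    | succ k => exact ⟨s (Fin.last k), hmonic _, fun i => hchain _ _ (Fin.le_last i)⟩
  have : Module.Finite F (AdjoinRoot m) := hm.finite_adjoinRoot
  have : IsArtinianRing (AdjoinRoot m) := IsArtinianRing.of_finite F _
  have hW : IsUnit (U⁻¹).det := by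
    rw [Matrix.isUnit_nonsing_inv_det_iff]; exact hU
  set W := U⁻¹ with hWdef
  have hWm : IsUnit (W.map (AdjoinRoot.mk m)).det := by
    have := hW.map (AdjoinRoot.mk m)
    rwa [RingHom.map_det] at this
  obtain ⟨P, hP, Lb, Ub, hL0, hL1, hU0, hE⟩ := exists_lu_aux (F := F) n _ hWm
  have hsurj := AdjoinRoot.mk_surjective (g := m)
  choose g hg using hsurj
  let L : Matrix (Fin n) (Fin n) F[X] := Matrix.of fun i j =>
    if i = j then 1 else if i < j then 0 else g (Lb i j)
  have hLmap : L.map (AdjoinRoot.mk m) = Lb := by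
    ext i j
    simp only [Matrix.map_apply, L, Matrix.of_apply]
    split_ifs with h1 h2
    · subst h1; simp [hL1]
    · simp [hL0 i j h2]
    · exact hg _
  have hLdet : L.det = 1 := by
    rw [Matrix.det_of_isLowerTriangular L (by
      intro i j hij
      have hij' : i < j := hij
      simp [L, hij', hij'.ne])]
    simp [L]
  set PC := P.map (Polynomial.C : F →+* F[X]) with hPC
  have hPCdet : IsUnit PC.det := by
    have := hP.map (Polynomial.C : F →+* F[X])
    rwa [RingHom.map_det] at this
  set M := PC * W with hM
  have hMdet : IsUnit M.det := by rw [hM, Matrix.det_mul]; exact hPCdet.mul hW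
  set N := M⁻¹ * L with hN
  have hMN : M * N = L := by rw [hN, Matrix.mul_nonsing_inv_cancel_left _ _ hMdet]
  have hNdet : IsUnit N.det := by
    have h := congrArg Matrix.det hMN
    rw [Matrix.det_mul, hLdet] at h
    exact IsUnit.of_mul_eq_one_right _ h
  have hMmap : M.map (AdjoinRoot.mk m) = Lb * Ub := by
    rw [← hE, hM, Matrix.map_mul]
    congr 1
  have hLbdet : Lb.det = 1 := by
    rw [← hLmap]
    have := congrArg (AdjoinRoot.mk m) hLdet
    rw [RingHom.map_det, map_one] at this
    exact this
  have hUN : Ub * N.map (AdjoinRoot.mk m) = 1 := by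
    have h := congrArg (fun X => X.map (AdjoinRoot.mk m)) hMN
    simp only [Matrix.map_mul, hMmap, hLmap] at h
    have h2 := congrArg (fun X => Lb⁻¹ * X) h
    have hu : IsUnit Lb.det := by rw [hLbdet]; exact isUnit_one
    simpa [Matrix.mul_assoc, Matrix.nonsing_inv_mul_cancel_left _ _ hu,
      Matrix.nonsing_inv_mul _ hu] using h2
  have hNtri : ∀ i j, j < i → m ∣ N i j := by
    intro i j hij
    rw [← AdjoinRoot.mk_eq_zero]
    have hNi : N.map (AdjoinRoot.mk m) = Ub⁻¹ := (Matrix.inv_eq_right_inv hUN).symm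
    let : Invertible Ub := ⟨_, mul_eq_one_comm.mp hUN, hUN⟩
    have hb : Matrix.BlockTriangular Ub id := fun i j h => hU0 i j h
    have h := Matrix.blockTriangular_inv_of_blockTriangular hb (i := i) (j := j) hij
    rw [← hNi] at h
    exact h
  have hdiv : ∀ i j, s i ∣ N i j * s j := by
    intro i j
    rcases lt_or_ge j i with h | h
    · exact ((hsm i).trans (hNtri i j h)).mul_right _
    · exact (hchain i j h).mul_left _
  choose Q hQ using hdiv
  let Q₀ : Matrix (Fin n) (Fin n) F[X] := Matrix.of Q
  set D := Matrix.diagonal s with hD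
  have hND : N * D = D * Q₀ := by
    ext1 i j
    rw [hD, Matrix.mul_diagonal, Matrix.diagonal_mul, hQ]
    rfl
  have hDdet : D.det ≠ 0 := by
    rw [hD, Matrix.det_diagonal]
    exact Finset.prod_ne_zero_iff.mpr fun i _ => (hmonic i).ne_zero
  have hQdet : IsUnit Q₀.det := by
    have h := congrArg Matrix.det hND
    rw [Matrix.det_mul N D, Matrix.det_mul D Q₀, mul_comm] at h
    rw [← mul_left_cancel₀ hDdet h]
    exact hNdet
  have hAV : A * V = W * D := by
    rw [← hUV, hWdef, Matrix.mul_assoc, Matrix.nonsing_inv_mul_cancel_left _ _ hU]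
  have hLD : L * D = PC * A * (V * Q₀) := by
    rw [← hMN, Matrix.mul_assoc, hND, hM]
    calc PC * W * (D * Q₀) = PC * (W * D) * Q₀ := by simp only [Matrix.mul_assoc]
      _ = _ := by rw [← hAV]; simp only [Matrix.mul_assoc]
  have hVQ : IsUnit (V * Q₀).det := by rw [Matrix.det_mul]; exact hV.mul hQdet
  refine ⟨L * D, ⟨P⁻¹, ?_, (V * Q₀)⁻¹, ?_, ?_⟩, ?_, ?_, ?_⟩
  · rw [Matrix.isUnit_nonsing_inv_det_iff]; exact hP
  · rw [Matrix.isUnit_nonsing_inv_det_iff]; exact hVQ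
  · have h1 : (P⁻¹).map (Polynomial.C : F →+* F[X]) * PC = 1 := by
      rw [hPC, ← Matrix.map_mul, Matrix.nonsing_inv_mul _ hP]
      simp
    rw [hLD]
    calc A = (P⁻¹).map (Polynomial.C : F →+* F[X]) * PC * A * ((V * Q₀) * (V * Q₀)⁻¹) := by
          rw [h1, Matrix.mul_nonsing_inv _ hVQ]; simp
      _ = _ := by simp only [Matrix.mul_assoc]
  · intro i j hij
    rw [hD, Matrix.mul_diagonal]
    simp [L, hij, hij.ne]
  · intro i
    rw [hD, Matrix.mul_diagonal]
    simp [L]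
  · intro i j hij
    rw [hD, Matrix.mul_diagonal]
    exact Dvd.intro_left _ rfl
end
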